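/- arXiv:math/9712292 — 4 statements merged into one kernel-verified Lean document; each statement's English description precedes it below -/
import Mathlib

section
/- Let G be a countable group and let r : ℕ → G × G be a surjective function (an enumeration of the pairs of elements of G). Let S = G × ℕ and let R ⊆ FreeGroup S consist of: (a) the words (FreeGroup.of (g, i)) * (FreeGroup.of (g, i+1))⁻¹ for all g ∈ G and i ∈ ℕ, and (b) for each i ∈ ℕ, writing (g, h) = r i, the single word (FreeGroup.of (g, i)) * (FreeGroup.of (h, i)) * (FreeGroup.of (g*h, i))⁻¹. Then the homomorphism FreeGroup S → G determined by sending the generator FreeGroup.of (g, i) to g kills every element of R and descends to a group isomorphism PresentedGroup R ≃* G. (This is the stabilized presentation of G by generators X_{g,i}, relations X_{g,i} X_{g,i+1}⁻¹ and R_i = X_{g,i} X_{h,i} (X_{gh,i})⁻¹ where (g,h) is the i-th pair, constructed in Example 3.6 of the paper.) -/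
/-- The stabilized presentation of a countable group `G` by generators `X_{g,i}`, with
relations `X_{g,i} X_{g,i+1}⁻¹` for all `g, i`, and relations `R_i = X_{g,i} X_{h,i} (X_{gh,i})⁻¹`
where `(g, h)` is the `i`-th pair in an enumeration of `G × G`: the homomorphism
`FreeGroup (G × ℕ) → G` sending `FreeGroup.of (g, i)` to `g` kills every relation and descends
to an isomorphism `PresentedGroup R ≃* G`. -/
theorem presentedGroup_stabilized (G : Type*) [Group G] [Countable G]
    (r : ℕ → G × G) (hr : Function.Surjective r)
    (R : Set (FreeGroup (G × ℕ)))
    (hR : R = {w : FreeGroup (G × ℕ) | ∃ (g : G) (i : ℕ),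
        w = FreeGroup.of (g, i) * (FreeGroup.of (g, i + 1))⁻¹} ∪
      {w : FreeGroup (G × ℕ) | ∃ i : ℕ,
        w = FreeGroup.of ((r i).1, i) * FreeGroup.of ((r i).2, i) *
          (FreeGroup.of ((r i).1 * (r i).2, i))⁻¹}) :
    (∀ x ∈ R, FreeGroup.lift (fun p : G × ℕ => p.1) x = 1) ∧
    ∃ e : PresentedGroup R ≃* G,
      ∀ x : FreeGroup (G × ℕ),
        e (PresentedGroup.mk R x) = FreeGroup.lift (fun p : G × ℕ => p.1) x := by
  have hkill : ∀ x ∈ R, FreeGroup.lift (fun p : G × ℕ => p.1) x = 1 := by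
    rw [hR]
    rintro x (⟨g, i, rfl⟩ | ⟨i, rfl⟩) <;> simp
  refine ⟨hkill, ?_⟩
  have hshift (g : G) (i : ℕ) :
      (PresentedGroup.of (g, i) : PresentedGroup R) = PresentedGroup.of (g, 0) := by
    induction i with
    | zero => rfl
    | succ i ih =>
      rw [← ih, eq_comm, ← mul_inv_eq_one]
      exact PresentedGroup.one_of_mem (hR ▸ Or.inl ⟨g, i, rfl⟩)
  have hmul (g h : G) : (PresentedGroup.of (g * h, 0) : PresentedGroup R) =
      PresentedGroup.of (g, 0) * PresentedGroup.of (h, 0) := by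
    obtain ⟨i, hi⟩ := hr (g, h)
    rw [← hshift _ i, ← hshift g i, ← hshift h i, eq_comm, ← mul_inv_eq_one]
    exact PresentedGroup.one_of_mem (hR ▸ Or.inr ⟨i, by rw [hi]⟩)
  refine ⟨MonoidHom.toMulEquiv (PresentedGroup.toGroup hkill)
    (MonoidHom.mk' (fun g => PresentedGroup.of (g, 0)) hmul) ?_ ?_, fun x => rfl⟩
  · ext ⟨g, i⟩
    simp [hshift g i]
  · ext g
    simp
end

section
/- Let S be a set and let R' ⊆ R ⊆ FreeGroup S. Suppose that the image of R' under the abelianization homomorphism FreeGroup S → Abelianization (FreeGroup S) generates the same subgroup as the image of R. Then the canonical surjective homomorphism PresentedGroup R' → PresentedGroup R (induced by the identity on generators, which is well defined since R' ⊆ R) induces an isomorphism between the abelianization of PresentedGroup R' and the abelianization of PresentedGroup R. (This is the mechanism by which, in Example 3.6 of the paper, one selects a subset of the relations of a presentation of G to obtain a group Ĝ with an epimorphism Ĝ → G inducing an isomorphism H₁(Ĝ;ℤ) → H₁(G;ℤ).) -/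
/-- A homomorphism from `G` to a commutative group that kills `T` also kills every set whose image
in the abelianization lies in the subgroup generated by the image of `T`. -/
theorem MonoidHom.eq_one_of_closure_abelianization_le {G A : Type*} [Group G] [CommGroup A]
    {T U : Set G}
    (hUT : Subgroup.closure ((Abelianization.of : G →* Abelianization G) '' U) ≤
      Subgroup.closure ((Abelianization.of : G →* Abelianization G) '' T))
    (f : G →* A) (hf : ∀ t ∈ T, f t = 1) {u : G} (hu : u ∈ U) : f u = 1 := by
  have hker : Subgroup.closure ((Abelianization.of : G →* Abelianization G) '' T) ≤
      (Abelianization.lift f).ker := by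
    rw [Subgroup.closure_le]
    rintro _ ⟨t, ht, rfl⟩
    simpa [MonoidHom.mem_ker] using hf t ht
  simpa [MonoidHom.mem_ker] using
    hker (hUT (Subgroup.subset_closure (Set.mem_image_of_mem _ hu)))

/-- If `R' ⊆ R` are sets of relations in `FreeGroup S` whose images in the abelianization of
`FreeGroup S` generate the same subgroup, then the canonical surjective homomorphism
`PresentedGroup R' → PresentedGroup R` (induced by the identity on generators) induces an
isomorphism on abelianizations. -/
theorem presentedGroup_subrelations_abelianization_iso (S : Type*)
    (R' R : Set (FreeGroup S)) (hsub : R' ⊆ R)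
    (hab : Subgroup.closure ((Abelianization.of : FreeGroup S →* Abelianization (FreeGroup S)) '' R')
      = Subgroup.closure ((Abelianization.of : FreeGroup S →* Abelianization (FreeGroup S)) '' R)) :
    ∃ φ : PresentedGroup R' →* PresentedGroup R,
      (∀ x : FreeGroup S, φ (PresentedGroup.mk R' x) = PresentedGroup.mk R x) ∧
      Function.Surjective φ ∧
      Function.Bijective (Abelianization.map φ) := by
  let φ : PresentedGroup R' →* PresentedGroup R :=
    QuotientGroup.map _ _ (MonoidHom.id _) (Subgroup.normalClosure_mono hsub)
  have hφ (x : FreeGroup S) : φ (PresentedGroup.mk R' x) = PresentedGroup.mk R x := rfl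
  have hsurj : Function.Surjective φ := fun y ↦ by
    obtain ⟨x, rfl⟩ := PresentedGroup.mk_surjective R y
    exact ⟨_, hφ x⟩
  let q : FreeGroup S →* Abelianization (PresentedGroup R') :=
    Abelianization.of.comp (PresentedGroup.mk R')
  have hq : ∀ r ∈ R, q r = 1 := fun r hr ↦
    q.eq_one_of_closure_abelianization_le hab.ge
      (fun t ht ↦ by simp [q, PresentedGroup.one_of_mem ht]) hr
  let ψ : PresentedGroup R →* Abelianization (PresentedGroup R') :=
    QuotientGroup.lift _ q (Subgroup.normalClosure_le_normal hq)
  have hψ (x : FreeGroup S) : ψ (PresentedGroup.mk R x) = q x := rfl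
  refine ⟨φ, hφ, hsurj, ?_, fun z ↦ ?_⟩
  · refine Function.LeftInverse.injective (g := Abelianization.lift ψ) fun z ↦ ?_
    obtain ⟨y, rfl⟩ := QuotientGroup.mk_surjective z
    obtain ⟨x, rfl⟩ := PresentedGroup.mk_surjective R' y
    exact hψ x
  · obtain ⟨y, rfl⟩ := QuotientGroup.mk_surjective z
    obtain ⟨x, rfl⟩ := hsurj y
    exact ⟨Abelianization.of x, Abelianization.map_of φ x⟩
end

section
/- Let M be a topological space equipped with an action of the additive group ℤ by homeomorphisms which is properly discontinuous, meaning that for every pair of compact subsets K, L ⊆ M the set { n ∈ ℤ : (n • K) ∩ L ≠ ∅ } is finite. Then for every compact subset K ⊆ M there exists an integer k ≥ 1 such that the translates (k * n) • K, for n ∈ ℤ, are pairwise disjoint: for all integers n ≠ m, ((k*n) • K) ∩ ((k*m) • K) = ∅. (This is the lemma, established in the proof of Theorem 6.1 of the paper, that given a properly discontinuous ℤ-action one can find an element all of whose powers translate a given compact set off of itself and off of each other.) -/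
/-- If the additive group `ℤ` acts on a topological space `M` by homeomorphisms
(`φ : ℤ → M ≃ₜ M` with `φ 0 = id` and `φ (m + n) = φ m ∘ φ n`) and the action is properly
discontinuous (for all compact `K, L ⊆ M` the set of `n` with `(φ n '' K) ∩ L ≠ ∅` is finite),
then for every compact `K ⊆ M` there is an integer `k ≥ 1` such that the translates
`φ (k * n) '' K`, `n ∈ ℤ`, are pairwise disjoint. -/
theorem properlyDiscontinuous_int_action_disjoint_translates
    (M : Type*) [TopologicalSpace M]
    (φ : ℤ → M ≃ₜ M)
    (hφ0 : ∀ x : M, φ 0 x = x)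
    (hφadd : ∀ m n : ℤ, ∀ x : M, φ (m + n) x = φ m (φ n x))
    (hpd : ∀ K L : Set M, IsCompact K → IsCompact L →
      {n : ℤ | (φ n '' K) ∩ L ≠ ∅}.Finite) :
    ∀ K : Set M, IsCompact K → ∃ k : ℤ, 1 ≤ k ∧
      ∀ n m : ℤ, n ≠ m → (φ (k * n) '' K) ∩ (φ (k * m) '' K) = ∅ := by
  intro K hK
  obtain ⟨B, hB⟩ := (hpd K K hK hK).bddAbove
  refine ⟨max B 0 + 1, by have := le_max_right B 0; omega, ?_⟩
  set k := max B 0 + 1 with hk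
  have hBk : B < k := by have := le_max_left B 0; omega
  have hk0 : 0 < k := by have := le_max_right B 0; omega
  intro n m hnm
  wlog hlt : m < n generalizing n m
  · rw [Set.inter_comm]
    exact this m n hnm.symm (by omega)
  by_contra hne
  obtain ⟨x, ⟨a, ha, hax⟩, b, hb, hbx⟩ := Set.nonempty_iff_ne_empty.mpr hne
  have hab : φ (k * (n - m)) a = b := by
    rw [show k * (n - m) = -(k * m) + k * n by ring, hφadd, hax, ← hbx, ← hφadd,
      neg_add_cancel, hφ0]
  have hle : k * (n - m) ≤ B :=
    hB (Set.nonempty_iff_ne_empty.mp ⟨b, ⟨a, ha, hab⟩, hb⟩)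
  have hge : k ≤ k * (n - m) := le_mul_of_one_le_right hk0.le (by omega)
  omega
end

section
/- For every countable group G there exists a connected, countable, locally finite CW complex X of dimension at most 2 whose fundamental group (based at any point) is isomorphic to G. (This is the CW-complex construction of Example 3.6 of the paper: using the stabilized presentation of G with generators X_{g,i} and relations X_{g,i} X_{g,i+1}⁻¹ and R_i — in which each generator occurs in only finitely many relations — one builds a connected, countable, locally finite 2-dimensional CW complex with π₁ ≅ G.) -/
open Metric

/-- A CW-structure of dimension at most 2 on a topological space `X`: a collection of cells of
dimensions `0`, `1`, `2`, each equipped with a characteristic map from the closed unit disk of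
the corresponding dimension, such that each characteristic map restricts to an embedding of the
open disk, the open cells partition `X`, the boundary sphere of each cell is attached to open
cells of strictly smaller dimension, and `X` carries the weak topology determined by the
characteristic maps.  The structure is moreover required to be countable (countably many cells)
and locally finite (every point has a neighborhood meeting only finitely many open cells). -/
structure TwoDimCWStructure (X : Type*) [TopologicalSpace X] where
  /-- the index type of the cells -/
  cell : Type
  /-- the dimension of each cell -/
  dim : cell → ℕ
  /-- the complex has dimension at most `2` -/
  dim_le_two : ∀ i, dim i ≤ 2
  /-- the characteristic map of each cell, defined on the closed unit disk -/
  charMap : ∀ i : cell,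
    C((closedBall (0 : EuclideanSpace ℝ (Fin (dim i))) 1 :
        Set (EuclideanSpace ℝ (Fin (dim i)))), X)
  /-- each characteristic map restricts to an embedding of the open disk -/
  embedding_on_interior : ∀ i : cell,
    Topology.IsEmbedding (fun y : (ball (0 : EuclideanSpace ℝ (Fin (dim i))) 1 :
        Set (EuclideanSpace ℝ (Fin (dim i)))) =>
      charMap i ⟨y.1, ball_subset_closedBall y.2⟩)
  /-- every point of `X` lies in exactly one open cell, at exactly one parameter value -/
  partition : ∀ x : X,
    ∃! p : Σ i : cell, (ball (0 : EuclideanSpace ℝ (Fin (dim i))) 1 :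
        Set (EuclideanSpace ℝ (Fin (dim i)))),
      charMap p.1 ⟨p.2.1, ball_subset_closedBall p.2.2⟩ = x
  /-- the boundary sphere of each cell is mapped into open cells of strictly smaller dimension -/
  attaching : ∀ i : cell,
    ∀ y : (closedBall (0 : EuclideanSpace ℝ (Fin (dim i))) 1 :
        Set (EuclideanSpace ℝ (Fin (dim i)))),
      (y : EuclideanSpace ℝ (Fin (dim i))) ∈ sphere (0 : EuclideanSpace ℝ (Fin (dim i))) 1 →
      ∃ j : cell, dim j < dim i ∧ ∃ z : EuclideanSpace ℝ (Fin (dim j)), ∃ hz : z ∈ ball 0 1,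
        charMap j ⟨z, ball_subset_closedBall hz⟩ = charMap i y
  /-- `X` carries the weak topology determined by the characteristic maps -/
  weak_topology : ∀ A : Set X, IsClosed A ↔ ∀ i : cell, IsClosed ((charMap i) ⁻¹' A)
  /-- the complex is countable: there are countably many cells -/
  countable_cells : Countable cell
  /-- the complex is locally finite: every point has a neighborhood meeting only finitely many
  open cells -/
  locallyFinite : ∀ x : X, ∃ U ∈ nhds x,
    {i : cell | (Set.range (fun y : (ball (0 : EuclideanSpace ℝ (Fin (dim i))) 1 :
        Set (EuclideanSpace ℝ (Fin (dim i)))) =>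
      charMap i ⟨y.1, ball_subset_closedBall y.2⟩)) ∩ U ≠ ∅}.Finite

section Nerve

open CategoryTheory unitInterval

variable {X : Type*} [TopologicalSpace X]

/-- A space is simply connected as soon as there is a choice of homotopy classes of paths to a
base point which is compatible with all sufficiently small paths. -/
theorem simplyConnectedSpace_of_locally_compatible {ι : Type*} (U : ι → Set X)
    (hU : ∀ i, IsOpen (U i)) (hcov : ∀ x, ∃ i, x ∈ U i) (b : X)
    (T : ∀ x, Path.Homotopic.Quotient x b)
    (hT : ∀ i x y (γ : Path x y), Set.range γ ⊆ U i →
      (Path.Homotopic.Quotient.mk γ).trans (T y) = T x) :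
    SimplyConnectedSpace X := by
  have key : ∀ x y (γ : Path x y), (Path.Homotopic.Quotient.mk γ).trans (T y) = T x := by
    intro x y γ
    obtain ⟨t, t0, tmono, ⟨n, hn⟩, ht⟩ := exists_monotone_Icc_subset_open_cover_unitInterval
      (c := fun i => γ ⁻¹' U i) (fun i => (hU i).preimage γ.continuous)
      (fun s _ => Set.mem_iUnion.2 (hcov (γ s)))
    have ind : ∀ m, (Path.Homotopic.Quotient.mk (γ.subpath 0 (t m))).trans (T (γ (t m)))
        = T (γ 0) := by
      intro m
      induction m with
      | zero =>
        rw [t0, Path.subpath_self]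
        exact Path.Homotopic.Quotient.refl_trans _
      | succ m ih =>
        obtain ⟨i, hi⟩ := ht m
        have h1 : Path.Homotopic.Quotient.mk (γ.subpath 0 (t (m + 1))) =
            (Path.Homotopic.Quotient.mk (γ.subpath 0 (t m))).trans
              (Path.Homotopic.Quotient.mk (γ.subpath (t m) (t (m + 1)))) :=
          (Path.Homotopic.Quotient.eq.2 ⟨Path.Homotopy.subpathTransSubpath γ 0 (t m) (t (m+1))⟩).symm
        rw [h1, Path.Homotopic.Quotient.trans_assoc, hT i, ih]
        rw [Path.range_subpath_of_le _ _ _ (tmono m.le_succ)]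
        exact Set.image_subset_iff.2 hi
    have := ind n
    rw [hn n le_rfl, Path.subpath_zero_one] at this
    have transport : ∀ x' y' (hx : x' = x) (hy : y' = y),
        (Path.Homotopic.Quotient.mk (γ.cast hx hy)).trans (T y') = T x' →
        (Path.Homotopic.Quotient.mk γ).trans (T y) = T x := by
      rintro _ _ rfl rfl h
      exact h
    exact transport _ _ _ _ this
  refine simply_connected_iff_paths_homotopic.2 ⟨⟨⟨b⟩, fun x y => ?_⟩, fun x y => ⟨fun p q => ?_⟩⟩
  · exact ⟨((T x).trans (T y).symm).out⟩
  · induction p using Quotient.inductionOn with | _ p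
    induction q using Quotient.inductionOn with | _ q
    have h := (key x y p).trans (key x y q).symm
    have h2 := congrArg (fun z => Path.Homotopic.Quotient.trans z (T y).symm) h
    simp only [Path.Homotopic.Quotient.trans_assoc, Path.Homotopic.Quotient.trans_symm,
      Path.Homotopic.Quotient.trans_refl] at h2
    exact h2

/-- In a simply connected subset any two points are joined by a homotopy class which
contains all paths inside the subset. -/
theorem IsSimplyConnected.exists_unique_class {s : Set X} (hs : IsSimplyConnected s)
    {x y : X} (hx : x ∈ s) (hy : y ∈ s) :
    ∃ c : FundamentalGroupoid.mk x ⟶ FundamentalGroupoid.mk y,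
      (∃ γ : Path x y, Set.range γ ⊆ s) ∧
      ∀ γ : Path x y, Set.range γ ⊆ s → Path.Homotopic.Quotient.mk γ = c := by
  have := hs.simplyConnectedSpace
  let p : Path (⟨x, hx⟩ : s) ⟨y, hy⟩ := PathConnectedSpace.somePath _ _
  refine ⟨Path.Homotopic.Quotient.mk (p.map continuous_subtype_val),
    ⟨p.map continuous_subtype_val, ?_⟩, fun γ hγ => ?_⟩
  · rintro _ ⟨t, rfl⟩
    exact (p t).2
  · let q : Path (⟨x, hx⟩ : s) ⟨y, hy⟩ :=
      { toFun := fun t => ⟨γ t, hγ ⟨t, rfl⟩⟩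
        source' := Subtype.ext γ.source
        target' := Subtype.ext γ.target }
    exact Path.Homotopic.Quotient.eq.2
      ((SimplyConnectedSpace.paths_homotopic q p).map ⟨Subtype.val, continuous_subtype_val⟩)

/-- A space covered by simply connected open sets with path connected pairwise intersections is
simply connected if every cocycle on the nerve of the cover is a coboundary. -/
theorem simplyConnectedSpace_of_nerve {ι : Type*} (U : ι → Set X)
    (hU : ∀ i, IsOpen (U i)) (hcov : ∀ x, ∃ i, x ∈ U i) (hsc : ∀ i, IsSimplyConnected (U i))
    (hpc : ∀ i j, (U i ∩ U j).Nonempty → IsPathConnected (U i ∩ U j))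
    (c : ι → X) (hc : ∀ i, c i ∈ U i) (b : X)
    (hcob : ∀ e : ∀ i j, (U i ∩ U j).Nonempty →
        (FundamentalGroupoid.mk (c i) ⟶ FundamentalGroupoid.mk (c j)),
      (∀ i j k hij hjk hik, (U i ∩ U j ∩ U k).Nonempty → e i j hij ≫ e j k hjk = e i k hik) →
      ∃ P : ∀ i, FundamentalGroupoid.mk (c i) ⟶ FundamentalGroupoid.mk b,
        ∀ i j hij, e i j hij ≫ P j = P i) :
    SimplyConnectedSpace X := by
  choose ρ hρe hρ using fun i x y (hx : x ∈ U i) (hy : y ∈ U i) =>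
    (hsc i).exists_unique_class hx hy
  have ρ_comp : ∀ i x y z hx hy hz, ρ i x y hx hy ≫ ρ i y z hy hz = ρ i x z hx hz := by
    intro i x y z hx hy hz
    obtain ⟨p, hp⟩ := hρe i x y hx hy
    obtain ⟨q, hq⟩ := hρe i y z hy hz
    rw [← hρ i x y hx hy p hp, ← hρ i y z hy hz q hq, ← hρ i x z hx hz (p.trans q)]
    · rfl
    · rw [Path.trans_range]
      exact Set.union_subset hp hq
  have ρ_agree : ∀ i j x y hxi hyi hxj hyj, ρ i x y hxi hyi = ρ j x y hxj hyj := by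
    intro i j x y hxi hyi hxj hyj
    obtain ⟨γ, hγ⟩ := (hpc i j ⟨x, hxi, hxj⟩).joinedIn x ⟨hxi, hxj⟩ y ⟨hyi, hyj⟩
    rw [← hρ i x y hxi hyi γ, ← hρ j x y hxj hyj γ]
    · rintro _ ⟨t, rfl⟩; exact (hγ t).2
    · rintro _ ⟨t, rfl⟩; exact (hγ t).1
  let e : ∀ i j, (U i ∩ U j).Nonempty →
      (FundamentalGroupoid.mk (c i) ⟶ FundamentalGroupoid.mk (c j)) := fun i j h =>
    ρ i (c i) h.some (hc i) h.some_mem.1 ≫ ρ j h.some (c j) h.some_mem.2 (hc j)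
  have he : ∀ i j h x hxi hxj, e i j h = ρ i (c i) x (hc i) hxi ≫ ρ j x (c j) hxj (hc j) := by
    intro i j h x hxi hxj
    have h1 := ρ_comp i (c i) x h.some (hc i) hxi h.some_mem.1
    have h2 := ρ_comp j x h.some (c j) hxj h.some_mem.2 (hc j)
    simp only [e]
    rw [← h1, ← h2, Category.assoc,
      ρ_agree i j x h.some hxi h.some_mem.1 hxj h.some_mem.2]
  have ρ_self : ∀ i x hx, ρ i x x hx hx = 𝟙 _ := by
    intro i x hx
    rw [← cancel_epi (ρ i x x hx hx), ρ_comp, Category.comp_id]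
  obtain ⟨P, hP⟩ := hcob e (by
    rintro i j k hij hjk hik ⟨x, ⟨hi, hj⟩, hk⟩
    rw [he i j hij x hi hj, he j k hjk x hj hk, he i k hik x hi hk, Category.assoc,
      ← Category.assoc (ρ j x (c j) hj (hc j)), ρ_comp j x (c j) x, ρ_self, Category.id_comp])
  choose v hv using hcov
  have hTind : ∀ x i (hi : x ∈ U i),
      ρ i x (c i) hi (hc i) ≫ P i = ρ (v x) x (c (v x)) (hv x) (hc _) ≫ P (v x) := by
    intro x i hi
    have hne : (U (v x) ∩ U i).Nonempty := ⟨x, hv x, hi⟩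
    rw [← hP (v x) i hne, he _ _ _ x (hv x) hi, Category.assoc, ← Category.assoc,
      ρ_comp (v x) x (c (v x)) x, ρ_self, Category.id_comp]
  refine simplyConnectedSpace_of_locally_compatible U hU (fun x => ⟨v x, hv x⟩) b
    (fun x => ρ (v x) x (c (v x)) (hv x) (hc _) ≫ P (v x)) ?_
  intro i x y γ hγ
  have hx : x ∈ U i := hγ ⟨0, γ.source⟩
  have hy : y ∈ U i := hγ ⟨1, γ.target⟩
  change (show FundamentalGroupoid.mk x ⟶ FundamentalGroupoid.mk y from
    Path.Homotopic.Quotient.mk γ) ≫ _ = _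
  rw [← hTind x i hx, ← hTind y i hy, hρ i x y hx hy γ hγ, ← Category.assoc, ρ_comp]

end Nerve

section Telescope

open CategoryTheory

/-- The vertices of the telescope of a group: a group element together with a level. -/
@[ext]
structure TelescopeVertex (G : Type*) where
  /-- the group element -/
  elt : G
  /-- the level -/
  level : ℕ

variable {G : Type*} [Group G]

/-- Two telescope vertices are adjacent (or equal) when their levels differ by at most two, their
group elements differ by an element of the set `S n` attached to the lower level `n`, and they
coincide if they have the same level. -/
def TelescopeRel (S : ℕ → Set G) (u v : TelescopeVertex G) : Prop :=
  u.elt⁻¹ * v.elt ∈ S (min u.level v.level) ∧ u.level ≤ v.level + 2 ∧ v.level ≤ u.level + 2 ∧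
    (u.level = v.level → u = v)

namespace TelescopeRel

variable {S : ℕ → Set G}

theorem refl (h1 : ∀ n, 1 ∈ S n) (u : TelescopeVertex G) : TelescopeRel S u u := by
  simp [TelescopeRel, h1]

theorem symm (hinv : ∀ n, ∀ g ∈ S n, g⁻¹ ∈ S n) {u v : TelescopeVertex G}
    (h : TelescopeRel S u v) : TelescopeRel S v u := by
  obtain ⟨h1, h2, h3, h4⟩ := h
  refine ⟨?_, h3, h2, fun h => (h4 h.symm).symm⟩
  simpa [min_comm] using hinv _ _ h1

theorem succ {g h : G} {n : ℕ} (hs : g⁻¹ * h ∈ S n) : TelescopeRel S ⟨g, n⟩ ⟨h, n + 1⟩ := by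
  refine ⟨by simpa using hs, ?_, ?_, ?_⟩ <;> simp
  omega

theorem add_two {g h : G} {n : ℕ} (hs : g⁻¹ * h ∈ S n) : TelescopeRel S ⟨g, n⟩ ⟨h, n + 2⟩ := by
  refine ⟨by simpa using hs, ?_, ?_, ?_⟩ <;> simp
  omega

/-- Every cocycle on the telescope of a group with values in a groupoid is a coboundary. -/
theorem exists_coboundary (h1 : ∀ n, 1 ∈ S n) (hinv : ∀ n, ∀ g ∈ S n, g⁻¹ ∈ S n)
    (hmono : Monotone S) (hex : ∀ g, ∃ n, g ∈ S n) {C : Type*} [Groupoid C]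
    (o : TelescopeVertex G → C) (e : ∀ u v, TelescopeRel S u v → (o u ⟶ o v))
    (he : ∀ u v w huv hvw huw, e u v huv ≫ e v w hvw = e u w huw) :
    ∃ P : ∀ u, o u ⟶ o ⟨1, 0⟩, ∀ u v huv, e u v huv ≫ P v = P u := by
  have e_self : ∀ u h, e u u h = 𝟙 _ := fun u h => by
    rw [← cancel_epi (e u u h), he, Category.comp_id]
  have e_inv : ∀ u v h h', e u v h = inv (e v u h') := fun u v h h' => by
    rw [← cancel_mono (e v u h'), he u v u h h' (refl h1 u), e_self, IsIso.inv_hom_id]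
  have vert : ∀ (g : G) n, g⁻¹ * g ∈ S n := fun g n => by simpa using h1 n
  let D₀ : ∀ g n, o ⟨g, 0⟩ ⟶ o ⟨g, n⟩ := fun g n =>
    Nat.rec (motive := fun n => o ⟨g, 0⟩ ⟶ o ⟨g, n⟩) (𝟙 _)
      (fun n f => f ≫ e ⟨g, n⟩ ⟨g, n + 1⟩ (succ (vert g n))) n
  have D₀_succ : ∀ g n, D₀ g (n + 1) = D₀ g n ≫ e ⟨g, n⟩ ⟨g, n + 1⟩ (succ (vert g n)) :=
    fun g n => rfl
  let D : ∀ g h n, g⁻¹ * h ∈ S n → (o ⟨g, 0⟩ ⟶ o ⟨h, 0⟩) := fun g h n hs =>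
    D₀ g n ≫ e ⟨g, n⟩ ⟨h, n + 1⟩ (succ hs) ≫ inv (D₀ h (n + 1))
  have D_step : ∀ g h n hs hs', D g h (n + 1) hs' = D g h n hs := by
    intro g h n hs hs'
    simp only [D, D₀_succ _ n, D₀_succ _ (n + 1), IsIso.inv_comp, Category.assoc]
    congr 1
    rw [← Category.assoc, ← Category.assoc, he _ _ _ _ _ (add_two hs),
      ← he ⟨g, n⟩ ⟨h, n + 1⟩ ⟨h, n + 2⟩ (succ hs) (succ (vert h (n + 1))) (add_two hs)]
    simp
  have D_le : ∀ g h n m hs hs', n ≤ m → D g h m hs' = D g h n hs := by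
    intro g h n m hs hs' hnm
    induction m, hnm using Nat.le_induction with
    | base => rfl
    | succ m hnm ih => rw [D_step g h m (hmono hnm hs) hs', ih (hmono hnm hs)]
  choose N hN using hex
  let E : ∀ g h, o ⟨g, 0⟩ ⟶ o ⟨h, 0⟩ := fun g h => D g h (N (g⁻¹ * h)) (hN _)
  have D_eq : ∀ g h n hs, D g h n hs = E g h := by
    intro g h n hs
    rcases le_total n (N (g⁻¹ * h)) with hn | hn
    · exact (D_le g h n _ hs (hN _) hn).symm
    · exact D_le g h _ n (hN _) hs hn
  have E_comp : ∀ g h k, E g h ≫ E h k = E g k := by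
    intro g h k
    let n := max (max (N (g⁻¹ * h)) (N (h⁻¹ * k))) (N (g⁻¹ * k))
    have hgh : g⁻¹ * h ∈ S n := hmono ((le_max_left _ _).trans (le_max_left _ _)) (hN _)
    have hhk : h⁻¹ * k ∈ S n := hmono ((le_max_right _ _).trans (le_max_left _ _)) (hN _)
    have hgk : g⁻¹ * k ∈ S n := hmono (le_max_right _ _) (hN _)
    rw [← D_eq g h n hgh, ← D_eq h k (n + 1) (hmono n.le_succ hhk), ← D_eq g k n hgk]
    simp only [D, D₀_succ k (n + 1), IsIso.inv_comp, Category.assoc, IsIso.inv_hom_id_assoc]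
    congr 1
    rw [← Category.assoc, he _ _ _ _ _ (add_two hgk),
      ← he ⟨g, n⟩ ⟨k, n + 1⟩ ⟨k, n + 2⟩ (succ hgk) (succ (vert k (n + 1))) (add_two hgk)]
    simp
  have E_self : ∀ g, E g g = 𝟙 _ := fun g => by
    rw [← cancel_epi (E g g), E_comp, Category.comp_id]
  have E_inv : ∀ g h, E g h = inv (E h g) := fun g h => by
    rw [← cancel_mono (E h g), E_comp, E_self, IsIso.inv_hom_id]
  have e_succ : ∀ g h n (hs : g⁻¹ * h ∈ S n), e ⟨g, n⟩ ⟨h, n + 1⟩ (succ hs) =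
      inv (D₀ g n) ≫ E g h ≫ D₀ h (n + 1) := by
    intro g h n hs
    rw [← D_eq g h n hs]
    simp [D]
  have e_lt : ∀ u v h, u.level < v.level →
      e u v h = inv (D₀ u.elt u.level) ≫ E u.elt v.elt ≫ D₀ v.elt v.level := by
    rintro ⟨g, n⟩ ⟨h, m⟩ ⟨hmin, _, hle, hne⟩ hlt
    simp only at hlt hle
    have hs : g⁻¹ * h ∈ S n := by simpa only [min_eq_left hlt.le] using hmin
    obtain rfl | rfl : m = n + 1 ∨ m = n + 2 := by omega
    · exact e_succ g h n hs
    · rw [← he ⟨g, n⟩ ⟨h, n + 1⟩ ⟨h, n + 2⟩ (succ hs) (succ (vert h (n + 1))) (add_two hs),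
        e_succ g h n hs, D₀_succ h (n + 1)]
      simp
  have e_eq : ∀ u v h, e u v h = inv (D₀ u.elt u.level) ≫ E u.elt v.elt ≫ D₀ v.elt v.level := by
    intro u v h
    rcases lt_trichotomy u.level v.level with hl | hl | hl
    · exact e_lt u v h hl
    · obtain rfl := h.2.2.2 hl
      rw [e_self, E_self]
      simp
    · rw [e_inv u v h (h.symm hinv), e_lt v u _ hl, E_inv u.elt v.elt]
      simp
  refine ⟨fun u => inv (D₀ u.elt u.level) ≫ E u.elt 1, fun u v h => ?_⟩
  rw [e_eq]
  simp [E_comp]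

end TelescopeRel

end Telescope

section FlagComplex

open Function Topology

variable {V : Type*} {R : V → V → Prop}

/-- A locally finite reflexive and symmetric relation. -/
class IsLocallyFiniteGraph (R : V → V → Prop) : Prop where
  refl : ∀ v, R v v
  symm : ∀ {v w}, R v w → R w v
  finite : ∀ v, {w | R v w}.Finite

/-- A finite nonempty set of pairwise related vertices. -/
structure IsFlagSimplex (R : V → V → Prop) (s : Finset V) : Prop where
  nonempty : s.Nonempty
  rel : ∀ v ∈ s, ∀ w ∈ s, R v w

variable (R) in
/-- The geometric realization of the flag complex of a relation, as a set of functions: the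
barycentric coordinates. -/
def flagComplex : Set (V → ℝ) :=
  {f | (∀ v, 0 ≤ f v) ∧ (∀ v w, f v ≠ 0 → f w ≠ 0 → R v w) ∧ ∑ᶠ v, f v = 1}

namespace flagComplex

theorem exists_ne_zero {f : V → ℝ} (hf : f ∈ flagComplex R) : ∃ v, f v ≠ 0 := by
  by_contra! h
  simpa [h] using hf.2.2

theorem pos_iff_ne_zero {f : V → ℝ} (hf : f ∈ flagComplex R) {v : V} : 0 < f v ↔ f v ≠ 0 :=
  ⟨ne_of_gt, fun h => (hf.1 v).lt_of_ne' h⟩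

theorem exists_pos {f : V → ℝ} (hf : f ∈ flagComplex R) : ∃ v, 0 < f v :=
  (exists_ne_zero hf).imp fun _ => (pos_iff_ne_zero hf).2

theorem finite_support {f : V → ℝ} (hf : f ∈ flagComplex R) : (support f).Finite := by
  by_contra h
  simpa [finsum_of_infinite_support h] using hf.2.2

/-- The support of a point of the flag complex. -/
noncomputable def supp (f : flagComplex R) : Finset V := (finite_support f.2).toFinset

theorem mem_supp {f : flagComplex R} {v : V} : v ∈ supp f ↔ f.1 v ≠ 0 := by
  simp [supp]

theorem isFlagSimplex_supp (f : flagComplex R) : IsFlagSimplex R (supp f) where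
  nonempty := (exists_ne_zero f.2).imp fun _ => mem_supp.2
  rel v hv w hw := f.2.2.1 v w (mem_supp.1 hv) (mem_supp.1 hw)

theorem sum_eq_one {f : V → ℝ} (hf : f ∈ flagComplex R) {s : Finset V}
    (hs : ∀ v, f v ≠ 0 → v ∈ s) : ∑ v ∈ s, f v = 1 := by
  rw [← hf.2.2, finsum_eq_sum_of_support_subset]
  exact fun v hv => hs v hv

theorem mem_of_simplex {s : Finset V} (hs : IsFlagSimplex R s) {f : V → ℝ} (h0 : ∀ v, 0 ≤ f v)
    (hf : ∀ v, f v ≠ 0 → v ∈ s) (h1 : ∑ v ∈ s, f v = 1) : f ∈ flagComplex R := by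
  refine ⟨h0, fun v w hv hw => hs.rel v (hf v hv) w (hf w hw), ?_⟩
  rw [← h1, finsum_eq_sum_of_support_subset]
  exact fun v hv => hf v hv

/-- The barycenter of a finite set of vertices. -/
noncomputable def barycenter (s : Finset V) : V → ℝ :=
  (s : Set V).indicator fun _ => (s.card : ℝ)⁻¹

theorem barycenter_pos {s : Finset V} {v : V} (hv : v ∈ s) : 0 < barycenter s v := by
  have : 0 < s.card := Finset.card_pos.2 ⟨v, hv⟩
  simpa [barycenter, hv]

theorem mem_of_barycenter_ne_zero {s : Finset V} {v : V} (hv : barycenter s v ≠ 0) : v ∈ s := by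
  by_contra h
  exact hv (by simp [barycenter, h])

theorem barycenter_mem {s : Finset V} (hs : IsFlagSimplex R s) :
    barycenter s ∈ flagComplex R := by
  refine mem_of_simplex hs (fun v => Set.indicator_nonneg (fun _ _ => by positivity) v)
    (fun v => mem_of_barycenter_ne_zero) ?_
  have : (s.card : ℝ) ≠ 0 := by simpa using hs.nonempty.ne_empty
  rw [Finset.sum_congr rfl (g := fun _ => (s.card : ℝ)⁻¹) fun v hv => by simp [barycenter, hv]]
  simp [this]

/-- The points of the flag complex all of whose coordinates in `s` are positive form a star
convex set. -/
theorem starConvex {s : Finset V} (hs : IsFlagSimplex R s) :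
    StarConvex ℝ (barycenter s) {f | f ∈ flagComplex R ∧ ∀ v ∈ s, 0 < f v} := by
  rintro f ⟨hf, hpos⟩ a b ha hb hab
  have hsupp : ∀ v, (a • barycenter s + b • f) v ≠ 0 → f v ≠ 0 := by
    intro v hv hfv
    have : v ∉ s := fun h => (hpos v h).ne' hfv
    exact hv (by simp [barycenter, hfv, this])
  refine ⟨mem_of_simplex (isFlagSimplex_supp ⟨f, hf⟩)
    (fun v => ?_) (fun v hv => mem_supp.2 (hsupp v hv)) ?_, fun v hv => ?_⟩
  · have := hf.1 v
    have := (barycenter_mem hs).1 v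
    simp only [Pi.add_apply, Pi.smul_apply, smul_eq_mul]
    positivity
  · simp only [Pi.add_apply, Pi.smul_apply, smul_eq_mul, Finset.sum_add_distrib,
      ← Finset.mul_sum]
    rw [sum_eq_one hf fun v hv => mem_supp.2 hv, sum_eq_one (barycenter_mem hs), mul_one, mul_one,
      hab]
    exact fun v hv => mem_supp.2 (hpos v (mem_of_barycenter_ne_zero hv)).ne'
  · have h1 := barycenter_pos hv
    have h2 := hpos v hv
    simp only [Pi.add_apply, Pi.smul_apply, smul_eq_mul]
    rcases ha.eq_or_lt with rfl | ha
    · have : b = 1 := by simpa using hab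
      simpa [this]
    · have := mul_pos ha h1
      have := mul_nonneg hb h2.le
      linarith

/-- The open star of a vertex. -/
def star (v : V) : Set (flagComplex R) := {f | 0 < f.1 v}

theorem mem_star {v : V} {f : flagComplex R} : f ∈ star v ↔ f.1 v ≠ 0 :=
  pos_iff_ne_zero f.2

theorem isOpen_star (v : V) : IsOpen (star (R := R) v) :=
  isOpen_lt continuous_const ((continuous_apply v).comp continuous_subtype_val)

theorem isSimplyConnected {s : Finset V} (hs : IsFlagSimplex R s) :
    IsSimplyConnected {f : flagComplex R | ∀ v ∈ s, f ∈ star v} := by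
  rw [← IsEmbedding.subtypeVal.isSimplyConnected_image]
  have : Subtype.val '' {f : flagComplex R | ∀ v ∈ s, f ∈ star v} =
      {f | f ∈ flagComplex R ∧ ∀ v ∈ s, 0 < f v} := by
    ext f
    simp [star, and_comm]
  rw [this]
  have := (starConvex hs).contractibleSpace
    ⟨barycenter s, barycenter_mem hs, fun v hv => barycenter_pos hv⟩
  exact SimplyConnectedSpace.ofContractible _

variable [IsLocallyFiniteGraph R]

theorem isFlagSimplex_pair [DecidableEq V] {v w : V} (h : R v w) :
    IsFlagSimplex R ({v, w} : Finset V) where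
  nonempty := by simp
  rel := by
    have := IsLocallyFiniteGraph.refl (R := R)
    have := IsLocallyFiniteGraph.symm h
    simp_all

open CategoryTheory in
/-- The flag complex of a graph is simply connected as soon as every cocycle on the graph with
values in a groupoid is a coboundary. -/
theorem simplyConnectedSpace (b : V)
    (hcob : ∀ (o : V → FundamentalGroupoid (flagComplex R)) (e : ∀ u v, R u v → (o u ⟶ o v)),
      (∀ u v w huv hvw huw, e u v huv ≫ e v w hvw = e u w huw) →
      ∃ P : ∀ u, o u ⟶ o b, ∀ u v huv, e u v huv ≫ P v = P u) :
    SimplyConnectedSpace (flagComplex R) := by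
  classical
  have hr := IsLocallyFiniteGraph.refl (R := R)
  have hs : ∀ {v w}, R v w → R w v := IsLocallyFiniteGraph.symm
  have h1 : ∀ v, IsFlagSimplex R {v} := fun v => by simpa using isFlagSimplex_pair (hr v)
  let c : V → flagComplex R := fun v => ⟨barycenter {v}, barycenter_mem (h1 v)⟩
  have hrel : ∀ {v w}, (star (R := R) v ∩ star w).Nonempty → R v w := by
    rintro v w ⟨f, hv, hw⟩
    exact f.2.2.1 v w (mem_star.1 hv) (mem_star.1 hw)
  have hne : ∀ {s : Finset V}, IsFlagSimplex R s → ∃ f : flagComplex R, ∀ v ∈ s, f ∈ star v :=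
    fun hs => ⟨⟨_, barycenter_mem hs⟩, fun v hv => barycenter_pos hv⟩
  have hpair : ∀ {v w}, R v w → (star (R := R) v ∩ star w).Nonempty := by
    intro v w h
    obtain ⟨f, hf⟩ := hne (isFlagSimplex_pair h)
    exact ⟨f, hf v (by simp), hf w (by simp)⟩
  refine simplyConnectedSpace_of_nerve star isOpen_star (fun f => exists_pos f.2)
    (fun v => by simpa using isSimplyConnected (h1 v))
    (fun v w h => by
      have := (isSimplyConnected (isFlagSimplex_pair (hrel h))).isPathConnected
      convert this
      ext
      simp)
    c (fun v => barycenter_pos (by simp)) (c b) fun e he => ?_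
  obtain ⟨P, hP⟩ := hcob (fun v => FundamentalGroupoid.mk (c v)) (fun u v h => e u v (hpair h))
    fun u v w huv hvw huw => he u v w _ _ _ <| by
      obtain ⟨f, hf⟩ := hne (s := {u, v, w})
        ⟨by simp, by simp [hr, huv, hvw, huw, hs huv, hs hvw, hs huw]⟩
      exact ⟨f, ⟨hf u (by simp), hf v (by simp)⟩, hf w (by simp)⟩
  exact ⟨P, fun u v h => hP u v (hrel h)⟩

end flagComplex

end FlagComplex

section FlagAction

open Function Topology

variable {V : Type*} {R : V → V → Prop} {G : Type*} [Group G] [MulAction G V]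

/-- A locally finite graph with a group action moving every vertex to a vertex which is
not adjacent to it. -/
class IsFreeFlagAction (G : Type*) {V : Type*} [Group G] [MulAction G V] (R : V → V → Prop) : Prop
    extends IsLocallyFiniteGraph R where
  smul_rel : ∀ (g : G) {v w : V}, R v w → R (g • v) (g • w)
  eq_one : ∀ {g : G} {v : V}, R v (g • v) → g = 1

namespace IsFreeFlagAction

theorem smul_left_injective [h : IsFreeFlagAction G R] (v : V) : Injective fun g : G => g • v := by
  intro g g' hg
  have : (g'⁻¹ * g) • v = v := by rw [mul_smul, inv_smul_eq_iff]; exact hg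
  exact (inv_mul_eq_one.1 (h.eq_one (v := v) (by rw [this]; exact h.refl v))).symm

end IsFreeFlagAction

namespace flagComplex

variable [hR : IsFreeFlagAction G R]

instance : MulAction G (flagComplex R) where
  smul g f := ⟨fun v => f.1 (g⁻¹ • v), fun v => f.2.1 _, fun v w hv hw => by
    simpa using IsFreeFlagAction.smul_rel g (f.2.2.1 _ _ hv hw), by
    rw [← f.2.2.2]
    exact finsum_comp_equiv (MulAction.toPerm (g⁻¹ : G))⟩
  one_smul f := by
    ext v
    exact congrArg f.1 (by simp)
  mul_smul g h f := by
    ext v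
    exact congrArg f.1 (by simp [mul_smul])

theorem smul_apply (g : G) (f : flagComplex R) (v : V) : (g • f).1 v = f.1 (g⁻¹ • v) := rfl

theorem smul_mem_star {g : G} {f : flagComplex R} {v : V} : g • f ∈ star v ↔ f ∈ star (g⁻¹ • v) :=
  Iff.rfl

instance : ContinuousConstSMul G (flagComplex R) where
  continuous_const_smul g := by
    refine Continuous.subtype_mk (continuous_pi fun v => ?_) _
    exact (continuous_apply (g⁻¹ • v)).comp continuous_subtype_val

theorem rel_of_mem_star {f : flagComplex R} {v w : V} (hv : f ∈ star v) (hw : f ∈ star w) :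
    R v w :=
  f.2.2.1 v w (mem_star.1 hv) (mem_star.1 hw)

theorem eq_one_of_smul_mem_star {g : G} {f : flagComplex R} {v : V} (hv : f ∈ star v)
    (hg : g • f ∈ star v) : g = 1 :=
  inv_eq_one.1 (hR.eq_one (rel_of_mem_star hv (smul_mem_star.1 hg)))

variable (R G) in
/-- The quotient of the flag complex by the group action. -/
abbrev OrbitSpace : Type _ := MulAction.orbitRel.Quotient G (flagComplex R)

variable (G) in
/-- The projection to the quotient of the flag complex by the group action. -/
def proj (f : flagComplex R) : OrbitSpace R G := Quotient.mk _ f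

theorem proj_eq_proj {f f' : flagComplex R} : proj G f = proj G f' ↔ ∃ g : G, g • f' = f :=
  Quotient.eq

theorem proj_smul (g : G) (f : flagComplex R) : proj G (g • f) = proj G f :=
  proj_eq_proj.2 ⟨g, rfl⟩

variable (R G) in
theorem isQuotientCoveringMap_proj : IsQuotientCoveringMap (proj (R := R) G) G where
  toIsQuotientMap := isQuotientMap_quot_mk
  toContinuousConstSMul := inferInstance
  apply_eq_iff_mem_orbit := Quotient.eq
  disjoint f := by
    obtain ⟨v, hv⟩ := exists_pos f.2
    refine ⟨star v, (isOpen_star v).mem_nhds hv, ?_⟩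
    rintro g ⟨_, ⟨f', hf', rfl⟩, hgf'⟩
    exact eq_one_of_smul_mem_star hf' hgf'

theorem continuous_proj : Continuous (proj (R := R) G) :=
  (isQuotientCoveringMap_proj R G).continuous

theorem isOpenMap_proj : IsOpenMap (proj (R := R) G) :=
  (isQuotientCoveringMap_proj R G).isOpenQuotientMap.isOpenMap

instance : T2Space (OrbitSpace R G) := by
  rw [t2Space_iff_of_isOpenQuotientMap (isQuotientCoveringMap_proj R G).isOpenQuotientMap]
  have : {p : flagComplex R × flagComplex R | proj G p.1 = proj G p.2} =
      ⋃ g : G, {p | g • p.2 = p.1} := by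
    ext p
    simp [proj_eq_proj]
  rw [this]
  refine LocallyFinite.isClosed_iUnion (fun p => ?_) fun g =>
    isClosed_eq (continuous_snd.const_smul g) continuous_fst
  obtain ⟨v, hv⟩ := exists_pos p.1.2
  obtain ⟨w, hw⟩ := exists_pos p.2.2
  refine ⟨star v ×ˢ star w,
    prod_mem_nhds ((isOpen_star v).mem_nhds hv) ((isOpen_star w).mem_nhds hw), ?_⟩
  refine ((hR.finite v).preimage (hR.smul_left_injective w).injOn).subset ?_
  rintro g ⟨⟨f, f'⟩, hg, hf, hf'⟩
  obtain rfl : g • f' = f := hg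
  exact rel_of_mem_star hf (smul_mem_star.2 (by simpa using hf'))

theorem connectedSpace_orbitSpace [SimplyConnectedSpace (flagComplex R)] :
    ConnectedSpace (OrbitSpace R G) :=
  (isQuotientCoveringMap_proj R G).surjective.connectedSpace continuous_proj

theorem nonempty_fundamentalGroup_mulEquiv [SimplyConnectedSpace (flagComplex R)]
    (x : OrbitSpace R G) : Nonempty (FundamentalGroup (OrbitSpace R G) x ≃* G) := by
  obtain ⟨f, hf⟩ := (isQuotientCoveringMap_proj R G).surjective x
  exact ⟨((isQuotientCoveringMap_proj R G).fundamentalGroupEquiv ⟨f, hf⟩).trans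
    (MulEquiv.inv' G).symm⟩

end flagComplex

end FlagAction

section CornerSimplex

/-- The full-dimensional simplex spanned by the origin and the standard basis vectors. -/
def cornerSimplex (d : ℕ) : Set (EuclideanSpace ℝ (Fin d)) :=
  {x | (∀ i, 0 ≤ x i) ∧ ∑ i, x i ≤ 1}

namespace cornerSimplex

variable {d : ℕ}

theorem convex : Convex ℝ (cornerSimplex d) := by
  rintro x ⟨hx, hx1⟩ y ⟨hy, hy1⟩ a b ha hb hab
  refine ⟨fun i => ?_, ?_⟩
  · have := mul_nonneg ha (hx i)
    have := mul_nonneg hb (hy i)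
    simp only [PiLp.add_apply, PiLp.smul_apply, smul_eq_mul]
    linarith
  · simp only [PiLp.add_apply, PiLp.smul_apply, smul_eq_mul, Finset.sum_add_distrib,
      ← Finset.mul_sum]
    nlinarith

theorem isClosed : IsClosed (cornerSimplex d) := by
  simp only [cornerSimplex, Set.ofPred_and, Set.ofPred_forall]
  exact (isClosed_iInter fun i => isClosed_le (by fun_prop) (by fun_prop)).inter
    (isClosed_le (by fun_prop) (by fun_prop))

theorem isBounded : Bornology.IsBounded (cornerSimplex d) := by
  refine (isBounded_iff_forall_norm_le).2 ⟨Real.sqrt d, fun x hx => ?_⟩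
  rw [EuclideanSpace.norm_eq]
  refine Real.sqrt_le_sqrt ?_
  calc ∑ i, ‖x i‖ ^ 2 ≤ ∑ i : Fin d, (1 : ℝ) := Finset.sum_le_sum fun i _ => by
        have h0 := hx.1 i
        have h1 : x i ≤ 1 :=
          (Finset.single_le_sum (fun j _ => hx.1 j) (Finset.mem_univ i)).trans hx.2
        rw [Real.norm_of_nonneg h0]
        exact pow_le_one₀ h0 h1
    _ = d := by simp

theorem interior_eq :
    interior (cornerSimplex d) = {x | (∀ i, 0 < x i) ∧ ∑ i, x i < 1} := by
  refine Set.Subset.antisymm (fun x hx => ?_) (interior_maximal ?_ ?_)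
  · let c : EuclideanSpace ℝ (Fin d) := WithLp.toLp 2 fun _ => ((d : ℝ) + 1)⁻¹
    have hd : (0 : ℝ) < ((d : ℝ) + 1)⁻¹ := by positivity
    have hdc : (d : ℝ) * ((d : ℝ) + 1)⁻¹ < 1 := by
      rw [← div_eq_mul_inv, div_lt_one (by positivity)]
      linarith
    have hcont : Filter.Tendsto (fun t : ℝ => x + t • (x - c)) (nhds 0) (nhds x) := by
      have : Continuous fun t : ℝ => x + t • (x - c) := by fun_prop
      simpa using this.tendsto 0
    have hev := (hcont.eventually (mem_interior_iff_mem_nhds.1 hx)).filter_mono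
      (nhdsWithin_le_nhds (s := Set.Ioi 0))
    obtain ⟨t, ⟨h0, h1⟩, ht⟩ := (hev.and self_mem_nhdsWithin).exists
    refine ⟨fun i => ?_, ?_⟩
    · have := h0 i
      simp only [PiLp.add_apply, PiLp.smul_apply, PiLp.sub_apply, smul_eq_mul, c] at this
      have := mul_pos ht hd
      by_contra! hi
      nlinarith
    · simp only [PiLp.add_apply, PiLp.smul_apply, PiLp.sub_apply, smul_eq_mul, c,
        Finset.sum_add_distrib, ← Finset.mul_sum, Finset.sum_sub_distrib, Finset.sum_const,
        Finset.card_univ, Fintype.card_fin, nsmul_eq_mul] at h1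
      by_contra! hi
      nlinarith
  · exact fun x hx => ⟨fun i => (hx.1 i).le, hx.2.le⟩
  · simp only [Set.ofPred_and, Set.ofPred_forall]
    exact (isOpen_iInter_of_finite fun i => isOpen_lt (by fun_prop) (by fun_prop)).inter
      (isOpen_lt (by fun_prop) (by fun_prop))

theorem interior_nonempty : (interior (cornerSimplex d)).Nonempty := by
  rw [interior_eq]
  refine ⟨WithLp.toLp 2 fun _ => ((d : ℝ) + 1)⁻¹, fun _ => by simp; positivity, ?_⟩
  simp only [Finset.sum_const, Finset.card_univ, Fintype.card_fin, nsmul_eq_mul]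
  rw [← div_eq_mul_inv, div_lt_one (by positivity)]
  linarith

end cornerSimplex

/-- The standard simplex is parametrized by the closed unit ball, the open ball corresponding to
the points with positive coordinates. -/
theorem exists_closedBall_param_stdSimplex {ι : Type*} [Fintype ι] {d : ℕ}
    (hd : Fintype.card ι = d + 1) :
    ∃ χ : closedBall (0 : EuclideanSpace ℝ (Fin d)) 1 → ι → ℝ, Continuous χ ∧
      Function.Injective χ ∧ Set.range χ = stdSimplex ℝ ι ∧
      ∀ y, y.1 ∈ ball (0 : EuclideanSpace ℝ (Fin d)) 1 ↔ ∀ i, 0 < χ y i := by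
  obtain ⟨h, hint, hcl, -⟩ := exists_homeomorph_image_interior_closure_frontier_eq_unitBall
    (cornerSimplex.convex (d := d)) cornerSimplex.interior_nonempty cornerSimplex.isBounded
  rw [cornerSimplex.isClosed.closure_eq] at hcl
  let σ : ι ≃ Fin (d + 1) := Fintype.equivFinOfCardEq hd
  let Φ : EuclideanSpace ℝ (Fin d) → ι → ℝ :=
    fun x i => Fin.cons (α := fun _ => ℝ) (1 - ∑ j, x j) (fun j => x j) (σ i)
  have hΦ : ∀ (p : ℝ → Prop) x, (∀ i, p (Φ x i)) ↔ p (1 - ∑ j, x j) ∧ ∀ j, p (x j) := by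
    intro p x
    rw [σ.forall_congr_left, Fin.forall_fin_succ]
    simp [Φ]
  have hK : ∀ y : closedBall (0 : EuclideanSpace ℝ (Fin d)) 1, h.symm y ∈ cornerSimplex d := by
    intro y
    obtain ⟨x, hx, hxy⟩ := hcl.ge y.2
    rwa [← hxy, h.symm_apply_apply]
  refine ⟨fun y => Φ (h.symm y), ?_, ?_, ?_, fun y => ?_⟩
  · refine continuous_pi fun i => ?_
    have : Continuous fun y : closedBall (0 : EuclideanSpace ℝ (Fin d)) 1 => h.symm y := by fun_prop
    simp only [Φ]
    refine Fin.cases ?_ (fun j => ?_) (σ i)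
    · simp only [Fin.cons_zero]
      fun_prop
    · simp only [Fin.cons_succ]
      fun_prop
  · intro y y' hyy'
    refine Subtype.ext (h.symm.injective (PiLp.ext fun j => ?_))
    simpa [Φ] using congrFun hyy' (σ.symm j.succ)
  · ext f
    constructor
    · rintro ⟨y, rfl⟩
      refine ⟨(hΦ _ _).2 ⟨sub_nonneg.2 (hK y).2, (hK y).1⟩, ?_⟩
      rw [← σ.symm.sum_comp]
      simp [Φ, Fin.sum_univ_succ]
    · rintro ⟨h0, h1⟩
      rw [← σ.symm.sum_comp, Fin.sum_univ_succ] at h1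
      let x : EuclideanSpace ℝ (Fin d) := WithLp.toLp 2 fun j => f (σ.symm j.succ)
      have hx : x ∈ cornerSimplex d := ⟨fun i => h0 _, by
        have := h0 (σ.symm 0)
        simp only [x]
        linarith⟩
      refine ⟨⟨h x, hcl ▸ Set.mem_image_of_mem _ hx⟩, funext fun i => ?_⟩
      obtain ⟨k, rfl⟩ := σ.symm.surjective i
      simp only [h.symm_apply_apply, Φ, σ.apply_symm_apply]
      refine Fin.cases ?_ (fun j => ?_) k
      · simp only [Fin.cons_zero, x]
        linarith
      · simp [x]
  · rw [hΦ, ← hint, h.image_eq_preimage_symm, Set.mem_preimage, cornerSimplex.interior_eq]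
    simp [and_comm]

end CornerSimplex

section FlagCells

open Function Topology

variable {V : Type*} {R : V → V → Prop} {G : Type*} [Group G] [MulAction G V]

namespace flagComplex

/-- The closed face spanned by a simplex is parametrized by the closed unit ball, the open ball
corresponding to the points whose support is the whole simplex. -/
theorem exists_charMap {s : Finset V} (hs : IsFlagSimplex R s) {d : ℕ} (hd : s.card = d + 1) :
    ∃ χ : C(closedBall (0 : EuclideanSpace ℝ (Fin d)) 1, flagComplex R),
      Injective χ ∧ Set.range χ = {f | supp f ⊆ s} ∧
      ∀ y, y.1 ∈ ball (0 : EuclideanSpace ℝ (Fin d)) 1 ↔ supp (χ y) = s := by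
  classical
  obtain ⟨χ, hcont, hinj, hrange, hball⟩ :=
    exists_closedBall_param_stdSimplex (ι := s) (d := d) (by simpa using hd)
  let E : (s → ℝ) → V → ℝ := fun x v => if h : v ∈ s then x ⟨v, h⟩ else 0
  have hE : ∀ x (v : s), E x v = x v := fun x v => by simp [E]
  have hEs : ∀ x v, E x v ≠ 0 → v ∈ s := fun x v h => by
    by_contra hv
    exact h (by simp [E, hv])
  have hmem : ∀ y, E (χ y) ∈ flagComplex R := fun y => by
    have hy : χ y ∈ stdSimplex ℝ s := hrange ▸ Set.mem_range_self y
    refine mem_of_simplex hs (fun v => ?_) (hEs _) ?_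
    · by_cases hv : v ∈ s
      · simpa [E, hv] using hy.1 ⟨v, hv⟩
      · simp [E, hv]
    · rw [← Finset.sum_coe_sort, ← hy.2]
      exact Finset.sum_congr rfl fun v _ => hE _ v
  refine ⟨⟨fun y => ⟨E (χ y), hmem y⟩, ?_⟩, fun y y' h => hinj (funext fun v => ?_), ?_,
    fun y => ?_⟩
  · refine Continuous.subtype_mk (continuous_pi fun v => ?_) _
    by_cases hv : v ∈ s
    · simpa [E, hv, comp_def] using (continuous_apply (⟨v, hv⟩ : s)).comp hcont
    · simpa [E, hv] using continuous_const
  · rw [← hE (χ y), ← hE (χ y')]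
    exact congrFun (congrArg Subtype.val h) v
  · ext f
    constructor
    · rintro ⟨y, rfl⟩ v hv
      exact hEs _ v (mem_supp.1 hv)
    · intro hf
      have : (fun v : s => f.1 v) ∈ Set.range χ := by
        rw [hrange]
        refine ⟨fun v => f.2.1 v, ?_⟩
        rw [Finset.sum_coe_sort s f.1]
        exact sum_eq_one f.2 fun v hv => hf (mem_supp.2 hv)
      obtain ⟨y, hy⟩ := this
      refine ⟨y, Subtype.ext (funext fun v => ?_)⟩
      by_cases hv : v ∈ s
      · exact (hE _ ⟨v, hv⟩).trans (congrFun hy ⟨v, hv⟩)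
      · have : f.1 v = 0 := by
          by_contra h
          exact hv (hf (mem_supp.2 h))
        simp [E, hv, this]
  · rw [hball]
    constructor
    · intro h
      refine Finset.Subset.antisymm (fun v hv => hEs _ v (mem_supp.1 hv)) fun v hv => ?_
      rw [mem_supp]
      exact (hE _ ⟨v, hv⟩).trans_ne (h ⟨v, hv⟩).ne'
    · intro h v
      rw [← hE (χ y)]
      exact (pos_iff_ne_zero (hmem y)).2 (mem_supp.1 (h.ge v.2))

variable (R) in
/-- The simplices of the flag complex. -/
abbrev Simplex : Type _ := {s : Finset V // IsFlagSimplex R s}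

/-- The simplex whose interior contains a given point. -/
noncomputable def carrier (f : flagComplex R) : Simplex R := ⟨supp f, isFlagSimplex_supp f⟩

theorem finite_setOf_mem_simplex [h : IsLocallyFiniteGraph R] (v : V) :
    {s : Simplex R | v ∈ s.1}.Finite := by
  refine ((h.finite v).toFinset.powerset.finite_toSet.preimage
    Subtype.val_injective.injOn).subset fun s hs => ?_
  simpa [Set.subset_def] using s.2.rel v hs

variable [hR : IsFreeFlagAction G R]

instance : SMul G (Simplex R) where
  smul g s := ⟨s.1.map (MulAction.toPerm g).toEmbedding, by simpa using s.2.nonempty, by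
    simp only [Finset.mem_map_equiv]
    intro v hv w hw
    simpa using IsFreeFlagAction.smul_rel g (s.2.rel _ hv _ hw)⟩

theorem mem_smul_simplex {g : G} {s : Simplex R} {v : V} : v ∈ (g • s).1 ↔ g⁻¹ • v ∈ s.1 :=
  Finset.mem_map_equiv

instance : MulAction G (Simplex R) where
  one_smul s := Subtype.ext <| by
    ext v
    simp [mem_smul_simplex]
  mul_smul g h s := Subtype.ext <| by
    ext v
    simp [mem_smul_simplex, mul_smul]

theorem card_smul_simplex (g : G) (s : Simplex R) : (g • s).1.card = s.1.card :=
  Finset.card_map _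

theorem carrier_smul (g : G) (f : flagComplex R) : carrier (g • f) = g • carrier f := by
  refine Subtype.ext (Finset.ext fun v => ?_)
  rw [mem_smul_simplex]
  exact mem_supp.trans (mem_supp (f := f)).symm

theorem eq_one_of_smul_simplex_eq {g : G} {s : Simplex R} (h : g • s = s) : g = 1 := by
  obtain ⟨v, hv⟩ := s.2.nonempty
  refine hR.eq_one (s.2.rel v hv _ ?_)
  rw [← h, mem_smul_simplex, inv_smul_smul]
  exact hv

variable (R G) in
/-- The cells of the orbit space: the orbits of simplices. -/
abbrev Cell : Type _ := MulAction.orbitRel.Quotient G (Simplex R)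

variable (G) in
/-- The cell whose interior contains the image of a given point of the flag complex. -/
noncomputable def carrierCell (f : flagComplex R) : Cell R G := Quotient.mk _ (carrier f)

namespace Cell

/-- A simplex representing a cell. -/
noncomputable def rep (i : Cell R G) : Simplex R := i.out

/-- The dimension of a cell. -/
noncomputable def dim (i : Cell R G) : ℕ := i.rep.1.card - 1

theorem mk_rep (i : Cell R G) : Quotient.mk _ i.rep = i := Quotient.out_eq i

theorem card_rep (i : Cell R G) : i.rep.1.card = i.dim + 1 := by
  have := i.rep.2.nonempty.card_pos
  rw [dim]
  omega

theorem exists_smul_eq_rep (s : Simplex R) :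
    ∃ g : G, g • s = rep (G := G) (Quotient.mk _ s) :=
  Quotient.exact (mk_rep (G := G) (Quotient.mk _ s))

theorem dim_carrierCell (f : flagComplex R) : (carrierCell G f).dim + 1 = (supp f).card := by
  obtain ⟨g, hg⟩ := exists_smul_eq_rep (G := G) (carrier f)
  rw [← card_rep, carrierCell, ← hg, card_smul_simplex]
  rfl

/-- The parametrization of the simplex representing a cell. -/
noncomputable def param (i : Cell R G) :
    C(closedBall (0 : EuclideanSpace ℝ (Fin i.dim)) 1, flagComplex R) :=
  (exists_charMap i.rep.2 i.card_rep).choose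

variable (i : Cell R G)

theorem param_injective : Injective i.param :=
  (exists_charMap i.rep.2 i.card_rep).choose_spec.1

theorem range_param : Set.range i.param = {f | supp f ⊆ i.rep.1} :=
  (exists_charMap i.rep.2 i.card_rep).choose_spec.2.1

variable {i}

theorem mem_ball_iff {y : closedBall (0 : EuclideanSpace ℝ (Fin i.dim)) 1} :
    y.1 ∈ ball (0 : EuclideanSpace ℝ (Fin i.dim)) 1 ↔ supp (i.param y) = i.rep.1 :=
  (exists_charMap i.rep.2 i.card_rep).choose_spec.2.2 y

theorem carrier_param {y : closedBall (0 : EuclideanSpace ℝ (Fin i.dim)) 1}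
    (hy : y.1 ∈ ball (0 : EuclideanSpace ℝ (Fin i.dim)) 1) : carrier (i.param y) = i.rep :=
  Subtype.ext (mem_ball_iff.1 hy)

theorem carrierCell_smul (g : G) (f : flagComplex R) :
    carrierCell G (g • f) = carrierCell G f :=
  Quotient.sound ⟨g, (carrier_smul g f).symm⟩

theorem carrierCell_eq_of_proj_eq {y : closedBall (0 : EuclideanSpace ℝ (Fin i.dim)) 1}
    (hy : y.1 ∈ ball (0 : EuclideanSpace ℝ (Fin i.dim)) 1) {f : flagComplex R}
    (h : proj G (i.param y) = proj G f) : carrierCell G f = i := by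
  obtain ⟨g, hg⟩ := proj_eq_proj.1 h
  rw [← carrierCell_smul g, hg, carrierCell, carrier_param hy, mk_rep]

theorem exists_proj_param_eq (f : flagComplex R) :
    ∃ y : closedBall (0 : EuclideanSpace ℝ (Fin (carrierCell G f).dim)) 1,
      y.1 ∈ ball (0 : EuclideanSpace ℝ (Fin (carrierCell G f).dim)) 1 ∧
      proj G ((carrierCell G f).param y) = proj G f := by
  obtain ⟨g, hg⟩ := exists_smul_eq_rep (G := G) (carrier f)
  rw [← carrier_smul] at hg
  have hs : supp (g • f) = (carrierCell G f).rep.1 := congrArg Subtype.val hg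
  obtain ⟨y, hy⟩ := (range_param (carrierCell G f)).ge hs.le
  exact ⟨y, mem_ball_iff.2 (by rw [hy, hs]), by rw [hy, proj_smul]⟩

theorem eq_of_proj_param_eq {y z : closedBall (0 : EuclideanSpace ℝ (Fin i.dim)) 1}
    (hy : y.1 ∈ ball (0 : EuclideanSpace ℝ (Fin i.dim)) 1)
    (hz : z.1 ∈ ball (0 : EuclideanSpace ℝ (Fin i.dim)) 1)
    (h : proj G (i.param y) = proj G (i.param z)) : y = z := by
  obtain ⟨g, hg⟩ := proj_eq_proj.1 h
  have h1 : g • i.rep = i.rep := by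
    rw [← carrier_param hz, ← carrier_smul, hg, carrier_param hy, carrier_param hz]
  rw [eq_one_of_smul_simplex_eq h1, one_smul] at hg
  exact (param_injective i hg).symm

variable (i)

/-- The characteristic map of a cell. -/
noncomputable def charMap : C(closedBall (0 : EuclideanSpace ℝ (Fin i.dim)) 1, OrbitSpace R G) :=
  ⟨fun y => proj G (i.param y), continuous_proj.comp i.param.continuous⟩

theorem charMap_apply (y : closedBall (0 : EuclideanSpace ℝ (Fin i.dim)) 1) :
    i.charMap y = proj G (i.param y) := rfl

theorem isOpenEmbedding_proj_star (v : V) :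
    IsOpenEmbedding fun f : star (R := R) v => proj G f.1 := by
  refine .of_continuous_injective_isOpenMap (continuous_proj.comp continuous_subtype_val) ?_
    (isOpenMap_proj.comp (isOpen_star v).isOpenMap_subtype_val)
  intro f f' h
  obtain ⟨g, hg⟩ := proj_eq_proj.1 h
  have h1 : g = 1 := eq_one_of_smul_mem_star f'.2 (hg ▸ f.2)
  rw [h1, one_smul] at hg
  exact Subtype.ext hg.symm

theorem isEmbedding_charMap :
    IsEmbedding fun y : ball (0 : EuclideanSpace ℝ (Fin i.dim)) 1 =>
      i.charMap ⟨y.1, ball_subset_closedBall y.2⟩ := by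
  obtain ⟨v, hv⟩ := i.rep.2.nonempty
  have h1 : IsEmbedding fun y : ball (0 : EuclideanSpace ℝ (Fin i.dim)) 1 =>
      i.param ⟨y.1, ball_subset_closedBall y.2⟩ :=
    (i.param.continuous.isClosedEmbedding i.param_injective).isEmbedding.comp
      (IsEmbedding.inclusion ball_subset_closedBall)
  have h2 := h1.codRestrict (star v) fun y => by
    rw [mem_star, ← mem_supp, mem_ball_iff (y := ⟨y.1, ball_subset_closedBall y.2⟩) |>.1 y.2]
    exact hv
  exact (isOpenEmbedding_proj_star v).isEmbedding.comp h2

theorem existsUnique_charMap_eq (x : OrbitSpace R G) :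
    ∃! p : Σ i : Cell R G, ball (0 : EuclideanSpace ℝ (Fin i.dim)) 1,
      p.1.charMap ⟨p.2.1, ball_subset_closedBall p.2.2⟩ = x := by
  obtain ⟨f, rfl⟩ := (isQuotientCoveringMap_proj R G).surjective x
  obtain ⟨y, hy, hyf⟩ := exists_proj_param_eq (G := G) f
  refine ⟨⟨_, y.1, hy⟩, hyf, ?_⟩
  rintro ⟨i, z, hz⟩ hzf
  have hi : carrierCell G f = i :=
    carrierCell_eq_of_proj_eq (y := ⟨z, ball_subset_closedBall hz⟩) hz hzf
  subst hi
  have := eq_of_proj_param_eq (y := ⟨z, ball_subset_closedBall hz⟩) hz hy (hzf.trans hyf.symm)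
  subst this
  rfl

theorem exists_charMap_eq_of_mem_sphere (y : closedBall (0 : EuclideanSpace ℝ (Fin i.dim)) 1)
    (hy : y.1 ∈ sphere (0 : EuclideanSpace ℝ (Fin i.dim)) 1) :
    ∃ j : Cell R G, j.dim < i.dim ∧ ∃ z : EuclideanSpace ℝ (Fin j.dim), ∃ hz : z ∈ ball 0 1,
      j.charMap ⟨z, ball_subset_closedBall hz⟩ = i.charMap y := by
  obtain ⟨z, hz, hzf⟩ := exists_proj_param_eq (G := G) (i.param y)
  refine ⟨_, ?_, z.1, hz, hzf⟩
  have h1 : supp (i.param y) ⊂ i.rep.1 := by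
    refine ((range_param i).le (Set.mem_range_self y)).ssubset_of_ne fun h => ?_
    exact (mem_ball.1 (mem_ball_iff.2 h)).ne hy
  have h2 := Finset.card_lt_card h1
  have h3 := dim_carrierCell (G := G) (i.param y)
  have h4 := card_rep i
  omega

variable {i}

theorem isClosed_iff (A : Set (OrbitSpace R G)) :
    IsClosed A ↔ ∀ i : Cell R G, IsClosed (i.charMap ⁻¹' A) := by
  refine ⟨fun h i => h.preimage i.charMap.continuous, fun h => ?_⟩
  rw [← (isQuotientCoveringMap_proj R G).toIsQuotientMap.isClosed_preimage]
  have : proj G ⁻¹' A = ⋃ s : Simplex R, {f | proj G f ∈ A ∧ supp f ⊆ s.1} := by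
    ext f
    simp only [Set.mem_preimage, Set.mem_iUnion, Set.mem_ofPred_eq, exists_and_left, iff_self_and]
    exact fun _ => ⟨carrier f, subset_rfl⟩
  rw [this]
  refine LocallyFinite.isClosed_iUnion (fun f => ?_) fun s => ?_
  · obtain ⟨v, hv⟩ := exists_pos f.2
    refine ⟨star v, (isOpen_star v).mem_nhds hv, (finite_setOf_mem_simplex v).subset ?_⟩
    rintro s ⟨f', ⟨-, hs⟩, hf'⟩
    exact hs (mem_supp.2 (mem_star.1 hf'))
  · obtain ⟨g, hg⟩ := exists_smul_eq_rep (G := G) s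
    have hK := ((h (Quotient.mk _ s)).isCompact.image
      (param (G := G) (Quotient.mk _ s)).continuous).image (continuous_const_smul g⁻¹)
    convert hK.isClosed
    ext f
    have key : g • f ∈ Set.range (param (G := G) (Quotient.mk _ s)) ↔ supp f ⊆ s.1 := by
      rw [range_param, ← hg, Set.mem_ofPred_eq]
      have : supp (g • f) = (g • carrier f).1 := congrArg Subtype.val (carrier_smul g f)
      rw [this]
      exact Finset.map_subset_map
    constructor
    · rintro ⟨hA, hs⟩
      obtain ⟨y, hy⟩ := key.2 hs
      refine ⟨g • f, ⟨y, ?_, hy⟩, inv_smul_smul g f⟩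
      rwa [Set.mem_preimage, charMap_apply, hy, proj_smul]
    · rintro ⟨_, ⟨y, hy, hyf⟩, rfl⟩
      rw [smul_inv_smul] at key
      refine ⟨?_, key.1 ⟨y, hyf⟩⟩
      rw [proj_smul, ← hyf]
      exact hy

end Cell

/-- The CW structure on the orbit space of a flag complex of dimension at most two. -/
noncomputable def twoDimCWStructure {V : Type} {R : V → V → Prop} [MulAction G V]
    [IsFreeFlagAction G R] [Countable V] (hcard : ∀ s : Simplex R, s.1.card ≤ 3) :
    TwoDimCWStructure (OrbitSpace R G) where
  cell := Cell R G
  dim := Cell.dim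
  dim_le_two i := by
    have := hcard i.rep
    have := i.card_rep
    omega
  charMap := Cell.charMap
  embedding_on_interior := Cell.isEmbedding_charMap
  partition := Cell.existsUnique_charMap_eq
  attaching := Cell.exists_charMap_eq_of_mem_sphere
  weak_topology := Cell.isClosed_iff
  countable_cells := inferInstance
  locallyFinite x := by
    obtain ⟨f, rfl⟩ := (isQuotientCoveringMap_proj R G).surjective x
    obtain ⟨v, hv⟩ := exists_pos f.2
    refine ⟨proj G '' star v, (isOpenMap_proj _ (isOpen_star v)).mem_nhds ⟨f, hv, rfl⟩, ?_⟩
    refine ((finite_setOf_mem_simplex v).image (Quotient.mk _)).subset fun i hi => ?_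
    obtain ⟨_, ⟨y, rfl⟩, f', hf', hyf'⟩ := Set.nonempty_iff_ne_empty.2 hi
    exact ⟨carrier f', mem_supp.2 (mem_star.1 hf'),
      Cell.carrierCell_eq_of_proj_eq (y := ⟨y.1, _⟩) y.2 hyf'.symm⟩

end flagComplex

end FlagCells

section TelescopeComplex

variable {G : Type*} [Group G] {S : ℕ → Set G}

instance : MulAction G (TelescopeVertex G) where
  smul g u := ⟨g * u.elt, u.level⟩
  one_smul _ := TelescopeVertex.ext (one_mul _) rfl
  mul_smul g h _ := TelescopeVertex.ext (mul_assoc g h _) rfl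

instance [Countable G] : Countable (TelescopeVertex G) :=
  Function.Injective.countable (f := fun u : TelescopeVertex G => (u.elt, u.level))
    fun _ _ h => TelescopeVertex.ext (congrArg Prod.fst h) (congrArg Prod.snd h)

namespace TelescopeRel

theorem isFreeFlagAction (h1 : ∀ n, 1 ∈ S n) (hinv : ∀ n, ∀ g ∈ S n, g⁻¹ ∈ S n)
    (hmono : Monotone S) (hfin : ∀ n, (S n).Finite) : IsFreeFlagAction G (TelescopeRel S) where
  refl := refl h1
  symm := symm hinv
  finite u := by
    refine (((hfin u.level).prod (Set.finite_Iic (u.level + 2))).image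
      fun p => (⟨u.elt * p.1, p.2⟩ : TelescopeVertex G)).subset ?_
    rintro v ⟨h, -, h', -⟩
    exact ⟨(u.elt⁻¹ * v.elt, v.level), ⟨hmono (min_le_left _ _) h, h'⟩, by simp⟩
  smul_rel g u v := by
    rintro ⟨h, h', h'', h'''⟩
    refine ⟨?_, h', h'', fun hl => congrArg (g • ·) (h''' hl)⟩
    change (g * u.elt)⁻¹ * (g * v.elt) ∈ S (min u.level v.level)
    simpa [mul_assoc] using h
  eq_one {g u} h := by
    have : u.elt = g * u.elt := congrArg TelescopeVertex.elt (h.2.2.2 rfl)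
    simpa using this

theorem card_le_three {s : Finset (TelescopeVertex G)} (hs : IsFlagSimplex (TelescopeRel S) s) :
    s.card ≤ 3 := by
  obtain ⟨u, hu, hmin⟩ := s.exists_min_image TelescopeVertex.level hs.nonempty
  calc s.card ≤ (Finset.Icc u.level (u.level + 2)).card :=
        Finset.card_le_card_of_injOn TelescopeVertex.level
          (fun v hv => by simpa using ⟨hmin v hv, (hs.rel u hu v hv).2.2.1⟩)
          fun v hv w hw h => (hs.rel v hv w hw).2.2.2 h
    _ = 3 := by simp; omega

end TelescopeRel

/-- A countable group is an increasing union of finite symmetric subsets containing the unit. -/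
theorem exists_monotone_finite_symmetric_exhaustion (G : Type*) [Group G] [Countable G] :
    ∃ S : ℕ → Set G, (∀ n, 1 ∈ S n) ∧ (∀ n, ∀ g ∈ S n, g⁻¹ ∈ S n) ∧ Monotone S ∧
      (∀ n, (S n).Finite) ∧ ∀ g, ∃ n, g ∈ S n := by
  obtain ⟨enc, henc⟩ := exists_injective_nat G
  have hfin : ∀ n, {g | enc g ≤ n}.Finite := fun n => (Set.finite_Iic n).preimage henc.injOn
  refine ⟨fun n => {1} ∪ ({g | enc g ≤ n} ∪ {g | enc g⁻¹ ≤ n}), fun n => by simp, ?_, ?_, ?_, ?_⟩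
  · rintro n g (h | h | h)
    · exact Or.inl (by simpa using h)
    · exact Or.inr (Or.inr (by simpa using h))
    · exact Or.inr (Or.inl h)
  · rintro m n hmn g (h | h | h)
    · exact Or.inl h
    · exact Or.inr (Or.inl (le_trans h hmn))
    · exact Or.inr (Or.inr (le_trans h hmn))
  · intro n
    exact (Set.finite_singleton 1).union
      ((hfin n).union ((hfin n).preimage inv_injective.injOn))
  · exact fun g => ⟨enc g, Or.inr (Or.inl (le_refl (enc g)))⟩

end TelescopeComplex

/-- Every countable group `G` is the fundamental group of a connected, countable, locally
finite CW complex of dimension at most `2` (based at any point). -/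
theorem exists_connected_countable_locallyFinite_twoDim_cw_with_pi1
    (G : Type*) [Group G] [Countable G] :
    ∃ (X : Type) (_ : TopologicalSpace X) (_ : T2Space X),
      Nonempty (TwoDimCWStructure X) ∧ ConnectedSpace X ∧
      ∀ x : X, Nonempty (FundamentalGroup X x ≃* G) := by
  have : Countable (Shrink.{0} G) := (equivShrink.{0} G).symm.injective.countable
  obtain ⟨S, h1, hinv, hmono, hfin, hex⟩ :=
    exists_monotone_finite_symmetric_exhaustion (Shrink.{0} G)
  have := TelescopeRel.isFreeFlagAction h1 hinv hmono hfin
  have : SimplyConnectedSpace (flagComplex (TelescopeRel S)) :=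
    flagComplex.simplyConnectedSpace ⟨1, 0⟩ fun o e he =>
      TelescopeRel.exists_coboundary h1 hinv hmono hex o e he
  exact ⟨flagComplex.OrbitSpace (TelescopeRel S) (Shrink.{0} G), inferInstance, inferInstance,
    ⟨flagComplex.twoDimCWStructure fun s => TelescopeRel.card_le_three s.2⟩,
    flagComplex.connectedSpace_orbitSpace, fun x =>
    (flagComplex.nonempty_fundamentalGroup_mulEquiv x).map fun e => e.trans Shrink.mulEquiv⟩
end
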